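/- Let F be a degree-three foliation of ℙ²(ℂ) whose singular locus consists of a single point, of algebraic multiplicity 3; equivalently, after a linear change of coordinates, F is given in the chart z = 1 by ω = A dx + B dy + C(x dy − y dx) with A, B, C ∈ ℂ[x,y] homogeneous of degree 3, such that the only common zeros in ℂ³∖{0} of the homogeneous coefficients (zA − yC, zB + xC, −(xA + yB)) of the associated 1-form Ω are the multiples of (0,0,1). Then ω is, up to the action of an automorphism of ℙ²(ℂ) (i.e. GL₃(ℂ)-pullback of Ω up to a nonzero scalar), of one of the following eight types: (1) x³dx + y²(cx + y)(xdy − ydx), c ∈ ℂ; (2) x³dx + y(x + cxy + y²)(xdy − ydx), c ∈ ℂ; (3) x³dx + (x² + cxy² + y³)(xdy − ydx), c ∈ ℂ; (4) x²y·dx + (x³ + cxy² + y³)(xdy − ydx), c ∈ ℂ; (5) x²y·dx + (x³ + δxy + y³)(xdy − ydx), δ ∈ ℂ*; (6) x²y·dy + (x³ + cxy² + y³)(xdy − ydx), c ∈ ℂ; (7) xy(xdy − λ·ydx) + (x³ + y³)(xdy − ydx), λ ∈ ℂ∖{0,1}; (8) xy(y − x)dx + (c₀x³ + c₁x²y + y³)(xdy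 − ydx), c₀(c₀ + c₁ + 1) ≠ 0. Moreover, 1-forms belonging to two different families among these eight are never linearly conjugate. -/

import Mathlib

open MvPolynomial

noncomputable section

/-- The inclusion `ℂ[x,y] → ℂ[x,y,z]`. -/
def emb : MvPolynomial (Fin 2) ℂ →ₐ[ℂ] MvPolynomial (Fin 3) ℂ :=
  rename Fin.castSucc

/-- The homogeneous projective 1-form
`Ω = (zA − yC) dx + (zB + xC) dy − (xA + yB) dz`
associated to the affine 1-form `ω = A dx + B dy + C (x dy − y dx)` of a degree-3
foliation with a singular point of algebraic multiplicity 3 at the origin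
(`A`, `B`, `C` homogeneous of degree 3). -/
def OmABC (A B Cc : MvPolynomial (Fin 2) ℂ) : Fin 3 → MvPolynomial (Fin 3) ℂ :=
  ![X 2 * emb A - X 1 * emb Cc,
    X 2 * emb B + X 0 * emb Cc,
    -(X 0 * emb A + X 1 * emb B)]

/-- Substitution of the linear change of variables on `ℂ³` given by the matrix `M`. -/
def subst3 (M : Matrix (Fin 3) (Fin 3) ℂ) (P : MvPolynomial (Fin 3) ℂ) :
    MvPolynomial (Fin 3) ℂ :=
  aeval (fun i => ∑ j, C (M i j) * X j) P

/-- Pullback of the 1-form with coefficient vector `Ω` by the linear map of matrix `M`. -/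
def pb3 (M : Matrix (Fin 3) (Fin 3) ℂ) (Ω : Fin 3 → MvPolynomial (Fin 3) ℂ) :
    Fin 3 → MvPolynomial (Fin 3) ℂ :=
  fun i => ∑ j, C (M j i) * subst3 M (Ω j)

/-- Two projective 1-forms are linearly conjugate: `T*Ω = c·Ω'` for some
`T ∈ GL₃(ℂ)` and `c ∈ ℂ*`. -/
def LinConj3 (Ω Ω' : Fin 3 → MvPolynomial (Fin 3) ℂ) : Prop :=
  ∃ (M : Matrix (Fin 3) (Fin 3) ℂ) (c : ℂ), IsUnit M.det ∧ c ≠ 0 ∧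
    pb3 M Ω = fun i => C c * Ω' i

/-- Family 1: `x³dx + y²(cx + y)(xdy − ydx)`. -/
def fam1 (c _q : ℂ) : Fin 3 → MvPolynomial (Fin 3) ℂ :=
  ![X 2 * X 0 ^ 3 - X 1 * (C c * X 0 * X 1 ^ 2 + X 1 ^ 3),
    X 0 * (C c * X 0 * X 1 ^ 2 + X 1 ^ 3), -(X 0 ^ 4)]

/-- Family 2: `x³dx + y(x + cxy + y²)(xdy − ydx)`. -/
def fam2 (c _q : ℂ) : Fin 3 → MvPolynomial (Fin 3) ℂ :=
  ![X 2 * X 0 ^ 3 - X 1 * (X 2 * X 0 * X 1 + C c * X 0 * X 1 ^ 2 + X 1 ^ 3),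
    X 0 * (X 2 * X 0 * X 1 + C c * X 0 * X 1 ^ 2 + X 1 ^ 3), -(X 0 ^ 4)]

/-- Family 3: `x³dx + (x² + cxy² + y³)(xdy − ydx)`. -/
def fam3 (c _q : ℂ) : Fin 3 → MvPolynomial (Fin 3) ℂ :=
  ![X 2 * X 0 ^ 3 - X 1 * (X 2 * X 0 ^ 2 + C c * X 0 * X 1 ^ 2 + X 1 ^ 3),
    X 0 * (X 2 * X 0 ^ 2 + C c * X 0 * X 1 ^ 2 + X 1 ^ 3), -(X 0 ^ 4)]

/-- Family 4: `x²y dx + (x³ + cxy² + y³)(xdy − ydx)`. -/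
def fam4 (c _q : ℂ) : Fin 3 → MvPolynomial (Fin 3) ℂ :=
  ![X 2 * X 0 ^ 2 * X 1 - X 1 * (X 0 ^ 3 + C c * X 0 * X 1 ^ 2 + X 1 ^ 3),
    X 0 * (X 0 ^ 3 + C c * X 0 * X 1 ^ 2 + X 1 ^ 3), -(X 0 ^ 3 * X 1)]

/-- Family 5: `x²y dx + (x³ + δxy + y³)(xdy − ydx)`. -/
def fam5 (d _q : ℂ) : Fin 3 → MvPolynomial (Fin 3) ℂ :=
  ![X 2 * X 0 ^ 2 * X 1 - X 1 * (X 0 ^ 3 + C d * X 2 * X 0 * X 1 + X 1 ^ 3),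
    X 0 * (X 0 ^ 3 + C d * X 2 * X 0 * X 1 + X 1 ^ 3), -(X 0 ^ 3 * X 1)]

/-- Family 6: `x²y dy + (x³ + cxy² + y³)(xdy − ydx)`. -/
def fam6 (c _q : ℂ) : Fin 3 → MvPolynomial (Fin 3) ℂ :=
  ![-(X 1 * (X 0 ^ 3 + C c * X 0 * X 1 ^ 2 + X 1 ^ 3)),
    X 2 * X 0 ^ 2 * X 1 + X 0 * (X 0 ^ 3 + C c * X 0 * X 1 ^ 2 + X 1 ^ 3),
    -(X 0 ^ 2 * X 1 ^ 2)]

/-- Family 7: `xy(xdy − λ ydx) + (x³ + y³)(xdy − ydx)`. -/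
def fam7 (l _q : ℂ) : Fin 3 → MvPolynomial (Fin 3) ℂ :=
  ![-(C l * X 2 * X 0 * X 1 ^ 2) - X 1 * (X 0 ^ 3 + X 1 ^ 3),
    X 2 * X 0 ^ 2 * X 1 + X 0 * (X 0 ^ 3 + X 1 ^ 3),
    (C l - 1) * X 0 ^ 2 * X 1 ^ 2]

/-- Family 8: `xy(y − x)dx + (c₀x³ + c₁x²y + y³)(xdy − ydx)`. -/
def fam8 (c₀ c₁ : ℂ) : Fin 3 → MvPolynomial (Fin 3) ℂ :=
  ![X 2 * (X 0 * X 1 ^ 2 - X 0 ^ 2 * X 1) -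
      X 1 * (C c₀ * X 0 ^ 3 + C c₁ * X 0 ^ 2 * X 1 + X 1 ^ 3),
    X 0 * (C c₀ * X 0 ^ 3 + C c₁ * X 0 ^ 2 * X 1 + X 1 ^ 3),
    -(X 0 ^ 2 * X 1 ^ 2 - X 0 ^ 3 * X 1)]

/-- The eight families, indexed by `Fin 8`. -/
def fam : Fin 8 → ℂ → ℂ → (Fin 3 → MvPolynomial (Fin 3) ℂ) :=
  ![fam1, fam2, fam3, fam4, fam5, fam6, fam7, fam8]

/-- The parameter constraints of the eight families. -/
def Par : Fin 8 → ℂ → ℂ → Prop :=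
  ![fun _ _ => True, fun _ _ => True, fun _ _ => True, fun _ _ => True,
    fun d _ => d ≠ 0, fun _ _ => True, fun l _ => l ≠ 0 ∧ l ≠ 1,
    fun c₀ c₁ => c₀ ≠ 0 ∧ c₀ + c₁ + 1 ≠ 0]

/-! ### Function-level reformulation -/

def OmF (A B K : ℂ → ℂ → ℂ) (v : Fin 3 → ℂ) : Fin 3 → ℂ :=
  ![v 2 * A (v 0) (v 1) - v 1 * K (v 0) (v 1),
    v 2 * B (v 0) (v 1) + v 0 * K (v 0) (v 1),
    -(v 0 * A (v 0) (v 1) + v 1 * B (v 0) (v 1))]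

def FC (F F' : (Fin 3 → ℂ) → (Fin 3 → ℂ)) : Prop :=
  ∃ (M : Matrix (Fin 3) (Fin 3) ℂ) (c : ℂ), IsUnit M.det ∧ c ≠ 0 ∧
    ∀ v, M.transpose.mulVec (F (M.mulVec v)) = c • F' v

theorem FC.trans {F G H : (Fin 3 → ℂ) → (Fin 3 → ℂ)} (h : FC F G) (h' : FC G H) : FC F H := by
  obtain ⟨M, c, hM, hc, h⟩ := h
  obtain ⟨N, d, hN, hd, h'⟩ := h'
  refine ⟨M * N, c * d, ?_, mul_ne_zero hc hd, fun v => ?_⟩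
  · rw [Matrix.det_mul]; exact hM.mul hN
  · rw [Matrix.transpose_mul, ← Matrix.mulVec_mulVec, ← Matrix.mulVec_mulVec, h,
      Matrix.mulVec_smul, h', smul_smul]

theorem eval_subst3 (M : Matrix (Fin 3) (Fin 3) ℂ) (P : MvPolynomial (Fin 3) ℂ) (v : Fin 3 → ℂ) :
    eval v (subst3 M P) = eval (M.mulVec v) P := by
  unfold subst3
  induction P using MvPolynomial.induction_on with
  | C a => simp
  | add p q hp hq => simp only [map_add, hp, hq]
  | mul_X p i hp =>
    simp only [map_mul, hp, aeval_X, eval_X]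
    simp [Matrix.mulVec, dotProduct]

theorem linConj3_iff (Ω Ω' : Fin 3 → MvPolynomial (Fin 3) ℂ) :
    LinConj3 Ω Ω' ↔ FC (fun v i => eval v (Ω i)) (fun v i => eval v (Ω' i)) := by
  unfold LinConj3 FC
  refine exists_congr fun M => exists_congr fun c => and_congr_right fun _ =>
    and_congr_right fun _ => ?_
  constructor
  · intro h v
    ext i
    have := congrArg (eval v) (congrFun h i)
    simp only [pb3, map_sum, map_mul, eval_C, eval_subst3] at this
    simpa [Matrix.mulVec, dotProduct] using this
  · intro h
    funext i
    apply MvPolynomial.funext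
    intro v
    have := congrFun (h v) i
    simp only [pb3, map_sum, map_mul, eval_C, eval_subst3]
    simpa [Matrix.mulVec, dotProduct] using this

def fA : Fin 8 → ℂ → ℂ → (ℂ → ℂ → ℂ) :=
  ![fun _ _ x _ => x ^ 3, fun _ _ x y => x ^ 3 - x * y ^ 2, fun _ _ x y => x ^ 3 - x ^ 2 * y,
    fun _ _ x y => x ^ 2 * y, fun d _ x y => x ^ 2 * y - d * x * y ^ 2, fun _ _ _ _ => 0,
    fun l _ x y => -(l * x * y ^ 2), fun _ _ x y => x * y * (y - x)]

def fB : Fin 8 → ℂ → ℂ → (ℂ → ℂ → ℂ) :=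
  ![fun _ _ _ _ => 0, fun _ _ x y => x ^ 2 * y, fun _ _ x _ => x ^ 3,
    fun _ _ _ _ => 0, fun d _ x y => d * x ^ 2 * y, fun _ _ x y => x ^ 2 * y,
    fun _ _ x y => x ^ 2 * y, fun _ _ _ _ => 0]

def fK : Fin 8 → ℂ → ℂ → (ℂ → ℂ → ℂ) :=
  ![fun c _ x y => c * x * y ^ 2 + y ^ 3, fun c _ x y => c * x * y ^ 2 + y ^ 3,
    fun c _ x y => c * x * y ^ 2 + y ^ 3, fun c _ x y => x ^ 3 + c * x * y ^ 2 + y ^ 3,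
    fun _ _ x y => x ^ 3 + y ^ 3, fun c _ x y => x ^ 3 + c * x * y ^ 2 + y ^ 3,
    fun _ _ x y => x ^ 3 + y ^ 3, fun c₀ c₁ x y => c₀ * x ^ 3 + c₁ * x ^ 2 * y + y ^ 3]

theorem fam_eval (i : Fin 8) (p q : ℂ) :
    (fun (v : Fin 3 → ℂ) k => eval v (fam i p q k)) = OmF (fA i p q) (fB i p q) (fK i p q) := by
  funext v k
  fin_cases i <;> fin_cases k <;>
    simp [fam, fam1, fam2, fam3, fam4, fam5, fam6, fam7, fam8, OmF, fA, fB, fK] <;> first | ring1 | (left; ring1)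

/-! ### Moves -/

def Res (A B K : ℂ → ℂ → ℂ) : Prop :=
  ∃ (i : Fin 8) (p q : ℂ), Par i p q ∧ FC (OmF A B K) (OmF (fA i p q) (fB i p q) (fK i p q))

theorem FC.refl (F : (Fin 3 → ℂ) → (Fin 3 → ℂ)) : FC F F :=
  ⟨1, 1, by simp, one_ne_zero, fun v => by simp⟩

theorem res_of (i : Fin 8) (p q : ℂ) (h : Par i p q) {A B K : ℂ → ℂ → ℂ}
    (hA : ∀ x y, A x y = fA i p q x y) (hB : ∀ x y, B x y = fB i p q x y)
    (hK : ∀ x y, K x y = fK i p q x y) : Res A B K := by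
  obtain rfl : A = fA i p q := by funext x y; exact hA x y
  obtain rfl : B = fB i p q := by funext x y; exact hB x y
  obtain rfl : K = fK i p q := by funext x y; exact hK x y
  exact ⟨i, p, q, h, FC.refl _⟩

theorem res_gl (a b c d : ℂ) (hd : a * d - b * c ≠ 0) {A B K : ℂ → ℂ → ℂ} (A' B' K' : ℂ → ℂ → ℂ)
    (hA : ∀ x y, A' x y = a * A (a * x + b * y) (c * x + d * y) +
      c * B (a * x + b * y) (c * x + d * y))
    (hB : ∀ x y, B' x y = b * A (a * x + b * y) (c * x + d * y) +
      d * B (a * x + b * y) (c * x + d * y))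
    (hK : ∀ x y, K' x y = (a * d - b * c) * K (a * x + b * y) (c * x + d * y))
    (h : Res A' B' K') : Res A B K := by
  obtain ⟨i, p, q, hP, h⟩ := h
  refine ⟨i, p, q, hP, FC.trans ?_ h⟩
  refine ⟨!![a, b, 0; c, d, 0; 0, 0, 1], 1, ?_, one_ne_zero, fun v => ?_⟩
  · simp [Matrix.det_fin_three]; simpa using hd
  · ext k
    fin_cases k <;>
      simp [OmF, Matrix.mulVec, dotProduct, Fin.sum_univ_three, hA, hB, hK] <;> ring

theorem res_sh (p q s t : ℂ) (hs : s ≠ 0) (ht : t ≠ 0) {A B K : ℂ → ℂ → ℂ} (A' B' K' : ℂ → ℂ → ℂ)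
    (hA : ∀ x y, A' x y = s * A x y) (hB : ∀ x y, B' x y = s * B x y)
    (hK : ∀ x y, K' x y = t * K x y + p * B x y - q * A x y)
    (h : Res A' B' K') : Res A B K := by
  obtain ⟨i, u, w, hP, h⟩ := h
  refine ⟨i, u, w, hP, FC.trans ?_ h⟩
  refine ⟨!![1, 0, 0; 0, 1, 0; p / t, q / t, s / t], 1 / t, ?_, by simpa using ht, fun v => ?_⟩
  · simp [Matrix.det_fin_three, hs, ht]
  · ext k
    fin_cases k <;>
      simp [OmF, Matrix.mulVec, dotProduct, Fin.sum_univ_three, hA, hB, hK] <;> field_simp <;> ring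

/-! ### Distinctness -/

def Good (A B K : ℂ → ℂ → ℂ) : Prop :=
  ∀ x y : ℂ, (x ≠ 0 ∨ y ≠ 0) → x * A x y + y * B x y = 0 → A x y = 0 ∧ B x y = 0 ∧ K x y ≠ 0

theorem good_fam (i : Fin 8) (p q : ℂ) (h : Par i p q) :
    Good (fA i p q) (fB i p q) (fK i p q) := by
  intro x y hxy h0
  fin_cases i <;> simp [fA, fB, fK, Par] at h h0 ⊢ <;> grind

theorem good_sing {A B K : ℂ → ℂ → ℂ} (hG : Good A B K) (v : Fin 3 → ℂ) (h : OmF A B K v = 0) :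
    v 0 = 0 ∧ v 1 = 0 := by
  have h0 := congrFun h 0
  have h1 := congrFun h 1
  have h2 := congrFun h 2
  simp [OmF] at h0 h1 h2
  by_contra hc
  have hxy : v 0 ≠ 0 ∨ v 1 ≠ 0 := by tauto
  obtain ⟨ha, hb, hk⟩ := hG _ _ hxy (by linear_combination -h2)
  simp [ha, hb, hk] at h0 h1
  tauto

def RC (A B A' B' : ℂ → ℂ → ℂ) : Prop :=
  ∃ a b c d k : ℂ, a * d - b * c ≠ 0 ∧ k ≠ 0 ∧
    (∀ x y, A' x y = k * (a * A (a * x + b * y) (c * x + d * y) +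
      c * B (a * x + b * y) (c * x + d * y))) ∧
    (∀ x y, B' x y = k * (b * A (a * x + b * y) (c * x + d * y) +
      d * B (a * x + b * y) (c * x + d * y)))

theorem RC.symm {A B A' B' : ℂ → ℂ → ℂ} (h : RC A B A' B') : RC A' B' A B := by
  obtain ⟨a, b, c, d, k, hd, hk, hA, hB⟩ := h
  set D := a * d - b * c with hD
  have key : ∀ x y : ℂ, a * (d / D * x + -b / D * y) + b * (-c / D * x + a / D * y) = x ∧
      c * (d / D * x + -b / D * y) + d * (-c / D * x + a / D * y) = y := by
    intro x y
    constructor <;> field_simp <;> rw [hD] <;> ring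
  refine ⟨d / D, -b / D, -c / D, a / D, 1 / k, ?_, by simpa using hk, fun x y => ?_, fun x y => ?_⟩
  · have : d / D * (a / D) - -b / D * (-c / D) = 1 / D := by
      field_simp; rw [hD]; ring
    rw [this]; simpa using hd
  · rw [hA, hB, (key x y).1, (key x y).2]
    field_simp; rw [hD]; ring
  · rw [hA, hB, (key x y).1, (key x y).2]
    field_simp; rw [hD]; ring

theorem RC_of_FC {A B K A' B' K' : ℂ → ℂ → ℂ} (hG : Good A B K)
    (hA0 : A' 0 0 = 0) (hB0 : B' 0 0 = 0)
    (h : FC (OmF A B K) (OmF A' B' K')) : RC A B A' B' := by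
  obtain ⟨M, c, hM, hc, h⟩ := h
  have e : M.transpose.mulVec (OmF A B K (M.mulVec ![0, 0, 1])) = 0 := by
    rw [h]
    ext i
    fin_cases i <;> simp [OmF, hA0, hB0]
  have hMt : IsUnit M.transpose.det := by rwa [Matrix.det_transpose]
  have e2 := Matrix.eq_zero_of_mulVec_eq_zero hMt.ne_zero e
  obtain ⟨z0, z1⟩ := good_sing hG _ e2
  simp [Matrix.mulVec, dotProduct, Fin.sum_univ_three] at z0 z1
  have hdet := hM.ne_zero
  rw [Matrix.det_fin_three, z0, z1] at hdet
  refine ⟨M 0 0, M 0 1, M 1 0, M 1 1, M 2 2 / c, ?_, ?_, fun x y => ?_, fun x y => ?_⟩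
  · intro hh
    apply hdet
    linear_combination M 2 2 * hh
  · intro hh
    have : M 2 2 = 0 := by simpa [hc] using hh
    apply hdet
    rw [this]; ring
  · have h1 := congrFun (h ![x, y, 1]) 0
    have h0 := congrFun (h ![x, y, 0]) 0
    simp [OmF, Matrix.mulVec, dotProduct, Fin.sum_univ_three, z0, z1] at h0 h1
    rw [div_mul_eq_mul_div, eq_div_iff hc]
    linear_combination h0 - h1
  · have h1 := congrFun (h ![x, y, 1]) 1
    have h0 := congrFun (h ![x, y, 0]) 1
    simp [OmF, Matrix.mulVec, dotProduct, Fin.sum_univ_three, z0, z1] at h0 h1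
    rw [div_mul_eq_mul_div, eq_div_iff hc]
    linear_combination h0 - h1

theorem t1 (a b c d k : ℂ) (hd : a * d - b * c ≠ 0) (hk : k ≠ 0) (P : ℂ → ℂ → ℂ)
    (h : ∀ x y, P x y = k * (a * x + b * y) ^ 4) (h1 : P 1 0 = 0) (h2 : P 0 1 = 0) : False := by
  rw [h] at h1 h2
  simp [hk] at h1 h2
  simp [h1, h2] at hd

theorem t2 (a b c d k : ℂ) (hd : a * d - b * c ≠ 0) (hk : k ≠ 0) (P : ℂ → ℂ → ℂ)
    (h : ∀ x y, P x y = k * (a * x + b * y) ^ 3 * (c * x + d * y))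
    (h1 : P 1 0 = 0) (h2 : P 0 1 = 0) (h3 : P 1 1 + P 1 (-1) ≠ 0) : False := by
  rw [h] at h1 h2
  rw [h, h] at h3
  simp [hk] at h1 h2
  grind

theorem t3 (a b c d k : ℂ) (hd : a * d - b * c ≠ 0) (hk : k ≠ 0) (P : ℂ → ℂ → ℂ)
    (h : ∀ x y, P x y = k * (a * x + b * y) ^ 2 * (c * x + d * y) ^ 2)
    (h1 : P 1 0 = 0) (h2 : P 0 1 = 0) (h3 : P 1 1 = 0) : False := by
  rw [h] at h1 h2 h3
  simp [hk] at h1 h2 h3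
  grind

set_option maxHeartbeats 1000000 in
theorem rc_lt (i j : Fin 8) (p q p' q' : ℂ) (hij : i < j) (hi : Par i p q) (hj : Par j p' q')
    (h : RC (fA i p q) (fB i p q) (fA j p' q') (fB j p' q')) : False := by
  obtain ⟨a, b, c, d, k, hd, hk, hA, hB⟩ := h
  have hP : ∀ x y, x * fA j p' q' x y + y * fB j p' q' x y =
      k * ((a * x + b * y) * fA i p q (a * x + b * y) (c * x + d * y) +
      (c * x + d * y) * fB i p q (a * x + b * y) (c * x + d * y)) := by
    intro x y; rw [hA, hB]; ring
  have hA1 := hA 1 0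
  have hA2 := hA 0 1
  have hA3 := hA 1 1
  have hA4 := hA 1 (-1)
  have hB1 := hB 1 0
  have hB2 := hB 0 1
  have hB3 := hB 1 1
  have hP1 := hP 1 0
  have hP2 := hP 0 1
  by_cases c1 : i < 3 ∧ 3 ≤ j
  · refine t1 a b c d k hd hk (fun x y => x * fA j p' q' x y + y * fB j p' q' x y)
      (fun x y => ?_) ?_ ?_
    · simp only [hP]
      obtain ⟨c1, -⟩ := c1
      fin_cases i <;> simp at c1 <;> simp [fA, fB] <;> first | done | ring1 | (left; ring1)
    · clear * - c1
      fin_cases j <;> simp at c1 <;> simp [fA, fB]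
    · clear * - c1
      fin_cases j <;> simp at c1 <;> simp [fA, fB]
  by_cases c2 : 3 ≤ i ∧ i < 5 ∧ 5 ≤ j
  · refine t2 a b c d k hd hk (fun x y => x * fA j p' q' x y + y * fB j p' q' x y)
      (fun x y => ?_) ?_ ?_ ?_
    · simp only [hP]
      obtain ⟨c1, c2, -⟩ := c2
      fin_cases i <;> simp at c1 c2 <;> simp [fA, fB] <;> ring
    · clear * - c2
      fin_cases j <;> simp at c2 <;> simp [fA, fB]
    · clear * - c2
      fin_cases j <;> simp at c2 <;> simp [fA, fB]
    · clear * - c2 hj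
      fin_cases j <;> simp at c2 <;> simp [fA, fB, Par] at hj ⊢ <;> grind
  by_cases c3 : 5 ≤ i ∧ j = 7
  · obtain ⟨c3, rfl⟩ := c3
    obtain ⟨m, hm, hm'⟩ : ∃ m : ℂ, m ≠ 0 ∧ ∀ x y, x * fA i p q x y + y * fB i p q x y =
        m * x ^ 2 * y ^ 2 := by
      clear * - c3 hi hij
      fin_cases i <;> simp at c3 hij
      · exact ⟨1, one_ne_zero, fun x y => by simp [fA, fB]; ring⟩
      · simp [Par] at hi
        exact ⟨1 - p, by grind, fun x y => by simp [fA, fB]; ring⟩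
    refine t3 a b c d (k * m) hd (mul_ne_zero hk hm)
      (fun x y => x * fA 7 p' q' x y + y * fB 7 p' q' x y) (fun x y => ?_) ?_ ?_ ?_
    · simp only [hP, hm']; ring
    · simp [fA, fB]
    · simp [fA, fB]
    · simp [fA, fB]
  fin_cases i <;> fin_cases j <;> simp at hij c1 c2 c3 <;> clear hP hA hB c1 c2 c3 <;>
    simp [fA, fB, Par] at hi hj hA1 hA2 hA3 hA4 hB1 hB2 hB3 hP1 hP2 <;>
    simp only [hk, false_or] at hA1 hA2 hA3 hA4 hB1 hB2 hB3 hP1 hP2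
  · simp [hB2] at hB3
  · simp [hB2] at hB3
  · have hb : b = 0 := by
      have : b ^ 4 = 0 := by linear_combination hB2
      simpa using this
    subst hb
    have ha : a ≠ 0 := by rintro rfl; simp at hd
    have hdd : d ≠ 0 := by rintro rfl; simp at hd
    have : k * d ^ 2 * a ^ 2 = 0 := by linear_combination hB1 - hB3
    simp [ha, hdd, hk] at this
  · rcases hP1 with rfl | rfl
    · simp at hA3 hA4
      have : (2 : ℂ) = 0 := by linear_combination hA3 - hA4
      norm_num at this
    · rcases hP2 with rfl | rfl
      · simp at hB3; exact hj hB3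
      · simp at hd
  · by_cases hc : c = 0
    · simp [hc] at hA3; exact hj.1 hA3
    · have ha : a = 0 := by tauto
      by_cases hdd : d = 0
      · simp [hdd] at hB3
      · have hb : b = 0 := by tauto
        simp [ha, hb] at hd

theorem distinct (i j : Fin 8) (p q p' q' : ℂ) (hij : i ≠ j) (hi : Par i p q) (hj : Par j p' q') :
    ¬ LinConj3 (fam i p q) (fam j p' q') := by
  intro h
  rw [linConj3_iff, fam_eval, fam_eval] at h
  have h := RC_of_FC (good_fam i p q hi) (by fin_cases j <;> simp [fA])
    (by fin_cases j <;> simp [fB]) h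
  rcases lt_or_gt_of_ne hij with h1 | h1
  · exact rc_lt _ _ _ _ _ _ h1 hi hj h
  · exact rc_lt _ _ _ _ _ _ h1 hj hi h.symm

/-! ### Existence -/

def cub (a b c d x y : ℂ) : ℂ := a * x ^ 3 + b * x ^ 2 * y + c * x * y ^ 2 + d * y ^ 3

theorem exists_cub (A : MvPolynomial (Fin 2) ℂ) (hA : A.IsHomogeneous 3) :
    ∃ a b c d : ℂ, ∀ v : Fin 3 → ℂ, eval v (emb A) = cub a b c d (v 0) (v 1) := by
  let m : ℕ → (Fin 2 →₀ ℕ) := fun i => Finsupp.single 0 (3 - i) + Finsupp.single 1 i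
  have h : A = ∑ i ∈ Finset.range 4, monomial (m i) (coeff (m i) A) := by
    ext e
    rw [coeff_sum]
    simp only [coeff_monomial]
    by_cases he : coeff e A = 0
    · rw [he]
      symm
      apply Finset.sum_eq_zero
      intro i _
      split_ifs with h
      · rw [h, he]
      · rfl
    · have h3 := hA he
      have h3 : e 0 + e 1 = 3 := by
        rw [Finsupp.weight_apply, Finsupp.sum_fintype _ _ (by simp)] at h3
        simpa using h3
      have hm : m (e 1) = e := by
        ext k
        fin_cases k <;> simp [m]
        omega
      rw [Finset.sum_eq_single (e 1)]
      · simp [hm]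
      · intro b _ hb
        rw [if_neg]
        intro hbe
        apply hb
        rw [← hbe]; simp [m]
      · intro hh
        simp at hh
        omega
  refine ⟨coeff (m 0) A, coeff (m 1) A, coeff (m 2) A, coeff (m 3) A, fun v => ?_⟩
  have hv : ∀ P, eval v (emb P) = eval (v ∘ Fin.castSucc) P := fun P => by
    simp [emb, eval_rename]
  rw [hv]
  conv_lhs => rw [h]
  simp only [map_sum, eval_monomial]
  simp only [Finset.sum_range_succ, Finset.sum_range_zero]
  have hp : ∀ i, ((m i).prod fun n e => (v ∘ Fin.castSucc) n ^ e) = v 0 ^ (3 - i) * v 1 ^ i := by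
    intro i
    rw [Finsupp.prod_fintype _ _ (by simp)]
    simp [m]
  simp only [hp, cub]
  norm_num
  ring

theorem root_or (p0 p1 p2 p3 p4 : ℂ) :
    (∃ t, p0 + p1 * t + p2 * t ^ 2 + p3 * t ^ 3 + p4 * t ^ 4 = 0) ∨
    (p0 ≠ 0 ∧ p1 = 0 ∧ p2 = 0 ∧ p3 = 0 ∧ p4 = 0) := by
  let f : Polynomial ℂ := Polynomial.C p0 + Polynomial.C p1 * Polynomial.X +
    Polynomial.C p2 * Polynomial.X ^ 2 + Polynomial.C p3 * Polynomial.X ^ 3 +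
    Polynomial.C p4 * Polynomial.X ^ 4
  have hf : ∀ t, f.eval t = p0 + p1 * t + p2 * t ^ 2 + p3 * t ^ 3 + p4 * t ^ 4 := by
    intro t; simp [f]
  by_cases hd : f.degree = 0
  · right
    have hc := Polynomial.eq_C_of_degree_eq_zero hd
    have h0 : f.coeff 0 ≠ 0 := by
      intro h; rw [h] at hc; rw [hc] at hd; simp at hd
    have e : ∀ n, f.coeff n = if n = 0 then f.coeff 0 else 0 := by
      intro n
      conv_lhs => rw [hc]
      rw [Polynomial.coeff_C]
    have e1 := e 1
    have e2 := e 2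
    have e3 := e 3
    have e4 := e 4
    simp [f, Polynomial.coeff_X, Polynomial.coeff_C, Polynomial.coeff_X_pow] at e1 e2 e3 e4 h0
    exact ⟨h0, e1, e2, e3, e4⟩
  · left
    obtain ⟨t, ht⟩ := IsAlgClosed.exists_root f hd
    exact ⟨t, by rw [← hf]; exact ht⟩

def IsCub (f : ℂ → ℂ → ℂ) : Prop := ∃ a b c d : ℂ, ∀ x y, f x y = cub a b c d x y

theorem IsCub.comp {f : ℂ → ℂ → ℂ} (h : IsCub f) (a b c d : ℂ) :
    IsCub (fun x y => f (a * x + b * y) (c * x + d * y)) := by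
  obtain ⟨p, q, r, s, h⟩ := h
  refine ⟨cub p q r s a c,
    p * 3 * a ^ 2 * b + q * (2 * a * b * c + a ^ 2 * d) + r * (b * c ^ 2 + 2 * a * c * d) +
      s * 3 * c ^ 2 * d,
    p * 3 * a * b ^ 2 + q * (b ^ 2 * c + 2 * a * b * d) + r * (a * d ^ 2 + 2 * b * c * d) +
      s * 3 * c * d ^ 2, cub p q r s b d, fun x y => ?_⟩
  simp only [h, cub]; ring

theorem IsCub.lin {f g : ℂ → ℂ → ℂ} (hf : IsCub f) (hg : IsCub g) (u w : ℂ) :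
    IsCub (fun x y => u * f x y + w * g x y) := by
  obtain ⟨p, q, r, s, h⟩ := hf
  obtain ⟨p', q', r', s', h'⟩ := hg
  refine ⟨u * p + w * p', u * q + w * q', u * r + w * r', u * s + w * s', fun x y => ?_⟩
  simp only [h, h', cub]; ring

structure GC (A B K : ℂ → ℂ → ℂ) : Prop where
  good : Good A B K
  cA : IsCub A
  cB : IsCub B
  cK : IsCub K

/-- Linear change of coordinates, keeping the hypotheses. -/
theorem gc_gl (a b c d : ℂ) (hd : a * d - b * c ≠ 0) {A B K : ℂ → ℂ → ℂ} (hG : GC A B K)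
    (h : ∀ A' B' K' : ℂ → ℂ → ℂ, GC A' B' K' →
      (∀ x y, A' x y = a * A (a * x + b * y) (c * x + d * y) +
        c * B (a * x + b * y) (c * x + d * y)) →
      (∀ x y, B' x y = b * A (a * x + b * y) (c * x + d * y) +
        d * B (a * x + b * y) (c * x + d * y)) → 
      Res A' B' K') : Res A B K := by
  refine res_gl a b c d hd _ _ _ (fun x y => rfl) (fun x y => rfl) (fun x y => rfl)
    (h _ _ _ ⟨?_, (hG.cA.comp a b c d).lin (hG.cB.comp a b c d) a c,
      (hG.cA.comp a b c d).lin (hG.cB.comp a b c d) b d, ?_⟩ (fun x y => rfl) (fun x y => rfl))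
  · intro x y hxy h0
    have h1 : a * x + b * y ≠ 0 ∨ c * x + d * y ≠ 0 := by
      by_contra hc
      push Not at hc
      obtain ⟨u, w⟩ := hc
      have hx : (a * d - b * c) * x = 0 := by linear_combination d * u - b * w
      have hy : (a * d - b * c) * y = 0 := by linear_combination a * w - c * u
      simp [hd] at hx hy
      tauto
    obtain ⟨h2, h3, h4⟩ := hG.good _ _ h1 (by linear_combination h0)
    simp [h2, h3, h4, hd]
  · obtain ⟨p, q, r, s, h⟩ := hG.cK.comp a b c d
    exact ⟨(a * d - b * c) * p, (a * d - b * c) * q, (a * d - b * c) * r, (a * d - b * c) * s,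
      fun x y => by simp only [h, cub]; ring⟩

theorem gc_nz {A B K : ℂ → ℂ → ℂ} (hG : GC A B K) (h : ∀ x y, x * A x y + y * B x y = 0) :
    False := by
  obtain ⟨a, b, c, d, hK⟩ := hG.cK
  rcases root_or a b c d 0 with ⟨t, ht⟩ | ⟨_, _, _, hd, _⟩
  · refine (hG.good 1 t (by simp) (h _ _)).2.2 ?_
    rw [hK]; simp only [cub]; linear_combination ht
  · refine (hG.good 0 1 (by simp) (h _ _)).2.2 ?_
    rw [hK]; simp [cub, hd]

/-! endings -/

theorem end123 (a u w c0 c1 c2 c3 : ℂ) (ha : a ≠ 0) (h3 : c3 ≠ 0) {A B : ℂ → ℂ → ℂ}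
    (hA : ∀ x y, A x y = a * x ^ 3 - u * x ^ 2 * y - w * x * y ^ 2)
    (hB : ∀ x y, B x y = u * x ^ 3 + w * x ^ 2 * y) : Res A B (cub c0 c1 c2 c3) := by
  by_cases hw : w = 0
  · subst hw
    by_cases hu : u = 0
    · subst hu
      obtain ⟨s, hs⟩ : ∃ s, c1 + 2 * c2 * s + 3 * c3 * s ^ 2 = 0 := by
        rcases root_or c1 (2 * c2) (3 * c3) 0 0 with ⟨s, hs⟩ | h
        · exact ⟨s, by linear_combination hs⟩
        · exfalso; simp [h3] at h
      refine res_gl 1 0 s 1 (by simp) (fun x y => a * x ^ 3) (fun x y => 0)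
        (cub (c0 + c1 * s + c2 * s ^ 2 + c3 * s ^ 3) 0 (c2 + 3 * c3 * s) c3)
        (fun x y => by rw [hA, hB]; ring) (fun x y => by rw [hA, hB]; ring)
        (fun x y => by simp only [cub]; linear_combination (-x ^ 2 * y) * hs) ?_
      refine res_sh 0 ((c0 + c1 * s + c2 * s ^ 2 + c3 * s ^ 3) / c3 / a) (1 / a) (1 / c3)
        (by simpa using ha) (by simpa using h3) _ _ _ (fun x y => rfl) (fun x y => rfl)
        (fun x y => rfl) ?_
      refine res_of 0 ((c2 + 3 * c3 * s) / c3) 0 (by simp [Par]) ?_ ?_ ?_ <;> intro x y <;>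
        simp [fA, fB, fK, cub] <;> field_simp <;> ring
    · -- family 3
      refine res_gl 1 0 0 (a / u) (by simp [ha, hu]) (fun x y => a * (x ^ 3 - x ^ 2 * y))
        (fun x y => a * x ^ 3)
        (cub (a / u * c0) (a / u * (a / u) * c1) (a / u * (a / u) ^ 2 * c2)
          (a / u * (a / u) ^ 3 * c3))
        (fun x y => by rw [hA, hB]; field_simp; ring)
        (fun x y => by rw [hA, hB]; field_simp; ring)
        (fun x y => by simp only [cub]; ring) ?_
      generalize a / u * c0 = d0
      generalize a / u * (a / u) * c1 = d1
      generalize a / u * (a / u) ^ 2 * c2 = d2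
      have h3' : a / u * (a / u) ^ 3 * c3 ≠ 0 := by simp [ha, hu, h3]
      revert h3'
      generalize a / u * (a / u) ^ 3 * c3 = d3
      intro h3'
      refine res_sh (-(d0 + d1) / d3 / a) (-d1 / d3 / a) (1 / a) (1 / d3)
        (by simpa using ha) (by simpa using h3') _ _ _ (fun x y => rfl) (fun x y => rfl)
        (fun x y => rfl) ?_
      refine res_of 2 (d2 / d3) 0 (by simp [Par]) ?_ ?_ ?_ <;> intro x y <;>
        simp [fA, fB, fK, cub] <;> field_simp <;> ring
  · -- family 2
    obtain ⟨e, he⟩ := IsAlgClosed.exists_pow_nat_eq (a / w) (n := 2) (by norm_num)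
    have he0 : e ≠ 0 := by
      rintro rfl
      have : a / w ≠ 0 := div_ne_zero ha hw
      apply this; rw [← he]; simp
    have hae : w * e ^ 2 = a := by rw [he]; field_simp
    refine res_gl 1 0 (-u / w) 1 (by simp) (fun x y => a * x ^ 3 - w * x * y ^ 2)
      (fun x y => w * x ^ 2 * y)
      (cub (c0 + c1 * (-u / w) + c2 * (-u / w) ^ 2 + c3 * (-u / w) ^ 3)
        (c1 + 2 * c2 * (-u / w) + 3 * c3 * (-u / w) ^ 2) (c2 + 3 * c3 * (-u / w)) c3)
        (fun x y => by rw [hA, hB]; field_simp; ring)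
        (fun x y => by rw [hA, hB]; field_simp; ring)
        (fun x y => by simp only [cub]; ring) ?_
    generalize c0 + c1 * (-u / w) + c2 * (-u / w) ^ 2 + c3 * (-u / w) ^ 3 = d0
    generalize c1 + 2 * c2 * (-u / w) + 3 * c3 * (-u / w) ^ 2 = d1
    generalize c2 + 3 * c3 * (-u / w) = d2
    refine res_gl 1 0 0 e (by simpa using he0) (fun x y => a * (x ^ 3 - x * y ^ 2))
      (fun x y => a * x ^ 2 * y) (cub (e * d0) (e ^ 2 * d1) (e ^ 3 * d2) (e ^ 4 * c3))
        (fun x y => by rw [← hae]; ring)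
        (fun x y => by rw [← hae]; ring)
        (fun x y => by simp only [cub]; ring) ?_
    refine res_sh (-(e ^ 2 * d1) / (e ^ 4 * c3) / a) ((e * d0) / (e ^ 4 * c3) / a) (1 / a)
        (1 / (e ^ 4 * c3))
        (by simpa using ha) (by simp [h3, he0]) _ _ _ (fun x y => rfl) (fun x y => rfl)
        (fun x y => rfl) ?_
    refine res_of 1 ((e ^ 3 * d2 + e * d0) / (e ^ 4 * c3)) 0 (by simp [Par]) ?_ ?_ ?_ <;> intro x y <;>
        simp [fA, fB, fK, cub] <;> field_simp <;> ring

theorem cube (c0 c3 : ℂ) (h0 : c0 ≠ 0) (h3 : c3 ≠ 0) : ∃ e : ℂ, e ≠ 0 ∧ c3 * e ^ 3 = c0 := by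
  obtain ⟨e, he⟩ := IsAlgClosed.exists_pow_nat_eq (c0 / c3) (n := 3) (by norm_num)
  refine ⟨e, ?_, by rw [he]; field_simp⟩
  rintro rfl
  have : c0 / c3 ≠ 0 := div_ne_zero h0 h3
  apply this; rw [← he]; simp

theorem end45 (a w c0 c1 c2 c3 : ℂ) (ha : a ≠ 0) (h0 : c0 ≠ 0) (h3 : c3 ≠ 0) {A B : ℂ → ℂ → ℂ}
    (hA : ∀ x y, A x y = a * x ^ 2 * y - w * x * y ^ 2)
    (hB : ∀ x y, B x y = w * x ^ 2 * y) : Res A B (cub c0 c1 c2 c3) := by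
  obtain ⟨e, he, hec⟩ := cube c0 c3 h0 h3
  refine res_gl 1 0 0 e (by simpa using he) (fun x y => e * (a * x ^ 2 * y - w * e * x * y ^ 2))
      (fun x y => w * e ^ 2 * x ^ 2 * y)
      (cub (e * c0) (e ^ 2 * c1) (e ^ 3 * c2) (e * c0))
        (fun x y => by rw [hA, hB]; ring)
        (fun x y => by rw [hA, hB]; ring)
        (fun x y => by simp only [cub]; rw [← hec]; ring) ?_
  by_cases hw : w = 0
  · subst hw
    refine res_sh 0 ((e ^ 2 * c1) / (e * c0) / (e * a)) (1 / (e * a)) (1 / (e * c0))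
      (by simp [he, ha]) (by simp [he, h0]) _ _ _ (fun x y => rfl) (fun x y => rfl)
        (fun x y => rfl) ?_
    refine res_of 3 (e ^ 3 * c2 / (e * c0)) 0 (by simp [Par]) ?_ ?_ ?_ <;> intro x y <;>
        simp [fA, fB, fK, cub] <;> field_simp <;> ring
  · refine res_sh (-(e ^ 2 * c1 + e * a * (e ^ 3 * c2 / (w * e ^ 2))) / (e * c0) / (w * e ^ 2))
      (-(e ^ 3 * c2) / (e * c0) / (w * e ^ 2)) (1 / (e * a)) (1 / (e * c0))
      (by simp [he, ha]) (by simp [he, h0]) _ _ _ (fun x y => rfl) (fun x y => rfl)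
        (fun x y => rfl) ?_
    refine res_of 4 (w * e / a) 0 (by simp [Par, hw, he, ha]) ?_ ?_ ?_ <;> intro x y <;>
        simp [fA, fB, fK, cub] <;> field_simp <;> ring

theorem end6 (w c0 c1 c2 c3 : ℂ) (hw : w ≠ 0) (h0 : c0 ≠ 0) (h3 : c3 ≠ 0) {A B : ℂ → ℂ → ℂ}
    (hA : ∀ x y, A x y = 0)
    (hB : ∀ x y, B x y = w * x ^ 2 * y) : Res A B (cub c0 c1 c2 c3) := by
  obtain ⟨e, he, hec⟩ := cube c0 c3 h0 h3
  refine res_gl 1 0 0 e (by simpa using he) (fun x y => 0)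
      (fun x y => w * e ^ 2 * x ^ 2 * y)
      (cub (e * c0) (e ^ 2 * c1) (e ^ 3 * c2) (e * c0))
        (fun x y => by rw [hA, hB]; ring)
        (fun x y => by rw [hA, hB]; ring)
        (fun x y => by simp only [cub]; rw [← hec]; ring) ?_
  refine res_sh (-(e ^ 2 * c1) / (e * c0) / (w * e ^ 2)) 0 (1 / (w * e ^ 2)) (1 / (e * c0))
      (by simp [he, hw]) (by simp [he, h0]) _ _ _ (fun x y => rfl) (fun x y => rfl)
        (fun x y => rfl) ?_
  refine res_of 5 (e ^ 3 * c2 / (e * c0)) 0 (by simp [Par]) ?_ ?_ ?_ <;> intro x y <;>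
        simp [fA, fB, fK, cub] <;> field_simp <;> ring

theorem end67 (u w c0 c1 c2 c3 : ℂ) (huw : u + w ≠ 0) (h0 : c0 ≠ 0) (h3 : c3 ≠ 0)
    {A B : ℂ → ℂ → ℂ}
    (hA : ∀ x y, A x y = u * x * y ^ 2)
    (hB : ∀ x y, B x y = w * x ^ 2 * y) : Res A B (cub c0 c1 c2 c3) := by
  by_cases hu : u = 0
  · subst hu
    exact end6 w c0 c1 c2 c3 (by simpa using huw) h0 h3 (by simp [hA]) hB
  by_cases hw : w = 0
  · subst hw
    refine res_gl 0 1 1 0 (by simp) (fun x y => 0) (fun x y => u * x ^ 2 * y)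
      (cub (-c3) (-c2) (-c1) (-c0)) (fun x y => by rw [hA, hB]; ring)
        (fun x y => by rw [hA, hB]; ring)
        (fun x y => by simp only [cub]; ring) ?_
    exact end6 u _ _ _ _ hu (by simpa using h3) (by simpa using h0) (by simp) (fun x y => rfl)
  obtain ⟨e, he, hec⟩ := cube c0 c3 h0 h3
  refine res_gl 1 0 0 e (by simpa using he) (fun x y => u * e ^ 2 * x * y ^ 2)
      (fun x y => w * e ^ 2 * x ^ 2 * y)
      (cub (e * c0) (e ^ 2 * c1) (e ^ 3 * c2) (e * c0))
        (fun x y => by rw [hA, hB]; ring)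
        (fun x y => by rw [hA, hB]; ring)
        (fun x y => by simp only [cub]; rw [← hec]; ring) ?_
  refine res_sh (-(e ^ 2 * c1) / (e * c0) / (w * e ^ 2))
      ((e ^ 3 * c2) / (e * c0) / (u * e ^ 2)) (1 / (w * e ^ 2)) (1 / (e * c0))
      (by simp [he, hw]) (by simp [he, h0]) _ _ _ (fun x y => rfl) (fun x y => rfl)
        (fun x y => rfl) ?_
  refine res_of 6 (-u / w) 0 ?_ ?_ ?_ ?_
  · simp only [Par]
    refine ⟨by simp [hu, hw], ?_⟩
    intro h
    rw [div_eq_one_iff_eq hw] at h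
    apply huw; rw [← h]; ring
  all_goals
    intro x y
    simp [fA, fB, fK, cub]
    field_simp
    try ring

theorem end8 (a c0 c1 c2 c3 : ℂ) (ha : a ≠ 0) (h0 : c0 ≠ 0) (h3 : c3 ≠ 0)
    (h1 : c0 + c1 + c2 + c3 ≠ 0) {A B : ℂ → ℂ → ℂ}
    (hA : ∀ x y, A x y = a * x * y * (y - x))
    (hB : ∀ x y, B x y = 0) : Res A B (cub c0 c1 c2 c3) := by
  refine res_sh 0 (c2 / c3 / a) (1 / a) (1 / c3)
      (by simp [ha]) (by simp [h3]) _ _ _ (fun x y => rfl) (fun x y => rfl)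
        (fun x y => rfl) ?_
  refine res_of 7 (c0 / c3) ((c1 + c2) / c3) ?_ ?_ ?_ ?_
  · simp only [Par]
    refine ⟨by simp [h0, h3], ?_⟩
    intro h
    apply h1
    field_simp at h
    linear_combination h
  all_goals
    intro x y
    simp [fA, fB, fK, cub, hA, hB]
    try field_simp
    try ring

theorem quad_cases (α β γ : ℂ) : (∃ t, t ≠ 0 ∧ α + β * t + γ * t ^ 2 = 0) ∨
    (β = 0 ∧ γ = 0) ∨ (α = 0 ∧ γ = 0) ∨ (α = 0 ∧ β = 0) := by
  by_contra hc
  push Not at hc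
  obtain ⟨h1, h2, h3, h4⟩ := hc
  by_cases hg : γ = 0
  · subst hg
    have hb : β ≠ 0 := fun h => h2 h rfl
    have ha : α ≠ 0 := fun h => h3 h rfl
    exact h1 (-α / β) (by simp [ha, hb]) (by field_simp; ring)
  · rcases root_or α β γ 0 0 with ⟨t, ht⟩ | h
    · by_cases h0 : t = 0
      · have ha : α = 0 := by simpa [h0] using ht
        have hb := h4 ha
        exact h1 (-β / γ) (by simp [hb, hg]) (by rw [ha]; field_simp; ring)
      · exact h1 t h0 (by linear_combination ht)
    · exact hg h.2.2.1

theorem case3 {A B K : ℂ → ℂ → ℂ} (hG : GC A B K) (a b : ℂ)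
    (hA : ∀ x y, A x y = a * x * y * (x - y)) (hB : ∀ x y, B x y = b * x * y * (x - y)) :
    Res A B K := by
  have hab : a ≠ 0 ∨ b ≠ 0 := by
    by_contra hc
    push Not at hc
    exact gc_nz hG (fun x y => by rw [hA, hB, hc.1, hc.2]; ring)
  obtain ⟨c0, c1, c2, c3, hK⟩ := hG.cK
  obtain rfl : K = cub c0 c1 c2 c3 := by funext x y; exact hK x y
  have k1 := (hG.good 1 0 (by simp) (by rw [hA, hB]; ring)).2.2
  have k2 := (hG.good 0 1 (by simp) (by rw [hA, hB]; ring)).2.2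
  have k3 := (hG.good 1 1 (by simp) (by rw [hA, hB]; ring)).2.2
  simp [cub] at k1 k2 k3
  obtain ⟨e1, e2, -⟩ := hG.good b (-a) (by simpa using hab.symm) (by rw [hA, hB]; ring)
  rw [hA] at e1
  rw [hB] at e2
  have h3 : a = 0 ∨ b = 0 ∨ a + b = 0 := by grind
  rcases h3 with rfl | rfl | h
  · simp at hab
    refine res_gl 0 1 1 0 (by simp) (fun x y => b * x * y * (y - x)) (fun x y => 0)
      (cub (-c3) (-c2) (-c1) (-c0)) (fun x y => by rw [hA, hB]; ring)
      (fun x y => by rw [hA, hB]; ring) (fun x y => by simp only [cub]; ring) ?_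
    refine end8 b _ _ _ _ hab (by simpa using k2) (by simpa using k1) ?_ (fun x y => rfl)
      (fun x y => rfl)
    intro h; apply k3; linear_combination -h
  · simp at hab
    refine end8 (-a) _ _ _ _ (by simpa using hab) k1 k2 k3 (fun x y => ?_) (fun x y => ?_)
    · rw [hA]; ring
    · rw [hB]; ring
  · have hb : b = -a := by linear_combination h
    subst hb
    have ha : a ≠ 0 := by simpa using hab
    refine res_gl 0 1 (-1) 1 (by simp) (fun x y => a * x * y * (y - x)) (fun x y => 0)
      (cub (-c3) (c2 + 3 * c3) (-c1 - 2 * c2 - 3 * c3) (c0 + c1 + c2 + c3))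
      (fun x y => by rw [hA, hB]; ring)
      (fun x y => by rw [hA, hB]; ring) (fun x y => by simp only [cub]; ring) ?_
    refine end8 a _ _ _ _ ha (by simpa using k2) k3 ?_ (fun x y => rfl)
      (fun x y => rfl)
    intro h; apply k1; linear_combination h

theorem case2 {A B K : ℂ → ℂ → ℂ} (hG : GC A B K) (a1 a2 b1 b2 : ℂ)
    (hA : ∀ x y, A x y = a1 * x ^ 2 * y + a2 * x * y ^ 2)
    (hB : ∀ x y, B x y = b1 * x ^ 2 * y + b2 * x * y ^ 2) :
    Res A B K := by
  rcases quad_cases a1 (a2 + b1) b2 with ⟨t, ht, h⟩ | h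
  · refine gc_gl 1 0 0 t (by simpa using ht) hG (fun A' B' K' hG' hA' hB' => ?_)
    obtain ⟨e1, e2, -⟩ := hG.good 1 t (by simp) (by rw [hA, hB]; linear_combination t * h)
    rw [hA] at e1
    rw [hB] at e2
    refine case3 hG' (t * a1) (t ^ 2 * b1) (fun x y => ?_) (fun x y => ?_)
    · rw [hA', hA, hB]; linear_combination x * y ^ 2 * t * e1 - x * y ^ 2 * (t - 1) * e1
    · rw [hB', hA, hB]; linear_combination x * y ^ 2 * t * e2
  · obtain ⟨c0, c1, c2, c3, hK⟩ := hG.cK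
    obtain rfl : K = cub c0 c1 c2 c3 := by funext x y; exact hK x y
    have k1 := (hG.good 1 0 (by simp) (by rw [hA, hB]; ring)).2.2
    have k2 := (hG.good 0 1 (by simp) (by rw [hA, hB]; ring)).2.2
    simp [cub] at k1 k2
    have hnz : ¬ (a1 = 0 ∧ a2 + b1 = 0 ∧ b2 = 0) := by
      rintro ⟨h1, h2, h3⟩
      refine gc_nz hG (fun x y => ?_)
      rw [hA, hB, h1, h3]
      linear_combination x ^ 2 * y ^ 2 * h2
    rcases h with ⟨h1, h2⟩ | ⟨h1, h2⟩ | ⟨h1, h2⟩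
    · refine end45 a1 b1 _ _ _ _ (by tauto) k1 k2 (fun x y => ?_) (fun x y => ?_)
      · rw [hA]; linear_combination x * y ^ 2 * h1
      · rw [hB, h2]; ring
    · refine end67 a2 b1 _ _ _ _ (by tauto) k1 k2 (fun x y => ?_) (fun x y => ?_)
      · rw [hA, h1]; ring
      · rw [hB, h2]; ring
    · refine res_gl 0 1 1 0 (by simp) (fun x y => b2 * x ^ 2 * y - a2 * x * y ^ 2)
        (fun x y => a2 * x ^ 2 * y)
        (cub (-c3) (-c2) (-c1) (-c0))
        (fun x y => by rw [hA, hB]; linear_combination (-x * y ^ 2) * h2)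
        (fun x y => by rw [hA, hB, h1]; ring) (fun x y => by simp only [cub]; ring) ?_
      exact end45 b2 a2 _ _ _ _ (by tauto) (by simpa using k2) (by simpa using k1)
        (fun x y => rfl) (fun x y => rfl)

theorem case1 {A B K : ℂ → ℂ → ℂ} (hG : GC A B K) (h1 : A 0 1 = 0) (h2 : B 0 1 = 0) :
    Res A B K := by
  obtain ⟨a0, a1, a2, a3, hA⟩ := hG.cA
  obtain ⟨b0, b1, b2, b3, hB⟩ := hG.cB
  obtain rfl : a3 = 0 := by rw [hA] at h1; simpa [cub] using h1
  obtain rfl : b3 = 0 := by rw [hB] at h2; simpa [cub] using h2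
  rcases root_or a0 (a1 + b0) (a2 + b1) b2 0 with ⟨t, ht⟩ | ⟨h0, h1, h2, h3, -⟩
  · refine gc_gl 1 0 t 1 (by simp) hG (fun A' B' K' hG' hA' hB' => ?_)
    obtain ⟨e1, e2, -⟩ := hG.good 1 t (by simp)
      (by rw [hA, hB]; simp only [cub]; linear_combination ht)
    rw [hA] at e1
    rw [hB] at e2
    simp only [cub] at e1 e2
    refine case2 hG' (a1 + 2 * a2 * t + t * (b1 + 2 * b2 * t)) (a2 + t * b2) (b1 + 2 * b2 * t) b2
      (fun x y => ?_) (fun x y => ?_)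
    · rw [hA', hA, hB]; simp only [cub]; linear_combination x ^ 3 * e1 + t * x ^ 3 * e2
    · rw [hB', hA, hB]; simp only [cub]; linear_combination x ^ 3 * e2
  · obtain ⟨c0, c1, c2, c3, hK⟩ := hG.cK
    obtain rfl : K = cub c0 c1 c2 c3 := by funext x y; exact hK x y
    have k2 := (hG.good 0 1 (by simp) (by rw [hA, hB]; simp [cub])).2.2
    simp [cub] at k2
    refine end123 a0 b0 b1 _ _ _ _ h0 k2 (fun x y => ?_) (fun x y => ?_)
    · rw [hA]; simp only [cub]; linear_combination x ^ 2 * y * h1 + x * y ^ 2 * h2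
    · rw [hB, h3]; simp only [cub]; ring

theorem case0 {A B K : ℂ → ℂ → ℂ} (hG : GC A B K) : Res A B K := by
  obtain ⟨a0, a1, a2, a3, hA⟩ := hG.cA
  obtain ⟨b0, b1, b2, b3, hB⟩ := hG.cB
  rcases root_or a0 (a1 + b0) (a2 + b1) (a3 + b2) b3 with ⟨t, ht⟩ | ⟨h0, h1, h2, h3, h4⟩
  · refine gc_gl 0 1 1 t (by simp) hG (fun A' B' K' hG' hA' hB' => ?_)
    obtain ⟨e1, e2, -⟩ := hG.good 1 t (by simp)
      (by rw [hA, hB]; simp only [cub]; linear_combination ht)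
    refine case1 hG' ?_ ?_
    · rw [hA']; simp [e1, e2]
    · rw [hB']; simp [e1, e2]
  · obtain ⟨e1, e2, -⟩ := hG.good 0 1 (by simp)
      (by rw [hA, hB]; simp only [cub]; linear_combination h4)
    exact case1 hG e1 e2

theorem existence (A B Cc : MvPolynomial (Fin 2) ℂ)
    (hA : A.IsHomogeneous 3) (hB : B.IsHomogeneous 3) (hC : Cc.IsHomogeneous 3)
    (hsing : ∀ v : Fin 3 → ℂ, v ≠ 0 →
      ((∀ i, eval v (OmABC A B Cc i) = 0) ↔ (v 0 = 0 ∧ v 1 = 0))) :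
    ∃ (i : Fin 8) (p q : ℂ), Par i p q ∧ LinConj3 (OmABC A B Cc) (fam i p q) := by
  obtain ⟨a0, a1, a2, a3, hA⟩ := exists_cub A hA
  obtain ⟨b0, b1, b2, b3, hB⟩ := exists_cub B hB
  obtain ⟨c0, c1, c2, c3, hC⟩ := exists_cub Cc hC
  have hO : (fun (v : Fin 3 → ℂ) i => eval v (OmABC A B Cc i)) =
      OmF (cub a0 a1 a2 a3) (cub b0 b1 b2 b3) (cub c0 c1 c2 c3) := by
    funext v i
    fin_cases i <;> simp [OmABC, OmF, hA, hB, hC]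
  have hs : ∀ v : Fin 3 → ℂ, (v 0 ≠ 0 ∨ v 1 ≠ 0) →
      OmF (cub a0 a1 a2 a3) (cub b0 b1 b2 b3) (cub c0 c1 c2 c3) v ≠ 0 := by
    intro v hv h0
    have hv0 : v ≠ 0 := by rintro rfl; simp at hv
    have := (hsing v hv0).1 (fun i => by
      have := congrFun (congrFun hO v) i
      rw [h0] at this
      simpa using this)
    tauto
  have key : GC (cub a0 a1 a2 a3) (cub b0 b1 b2 b3) (cub c0 c1 c2 c3) := by
    refine ⟨?_, ⟨a0, a1, a2, a3, fun _ _ => rfl⟩, ⟨b0, b1, b2, b3, fun _ _ => rfl⟩,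
      ⟨c0, c1, c2, c3, fun _ _ => rfl⟩⟩
    revert hs
    generalize cub a0 a1 a2 a3 = A
    generalize cub b0 b1 b2 b3 = B
    generalize cub c0 c1 c2 c3 = K
    intro hs x y hxy h0
    have hs' : ∀ z, z * A x y - y * K x y = 0 → z * B x y + x * K x y = 0 → False := by
      intro z h1 h2
      apply hs ![x, y, z] (by simpa using hxy)
      ext i
      fin_cases i <;> simp [OmF]
      · exact h1
      · exact h2
      · linear_combination -h0
    by_cases hBz : B x y = 0
    · by_cases hAz : A x y = 0
      · refine ⟨hAz, hBz, fun hKz => hs' 0 ?_ ?_⟩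
        · simp [hKz]
        · simp [hKz]
      · exfalso
        have hx : x = 0 := by simpa [hBz, hAz] using h0
        refine hs' (y * K x y / A x y) ?_ ?_
        · field_simp; ring
        · rw [hBz, hx]; ring
    · exfalso
      refine hs' (-(x * K x y) / B x y) ?_ ?_
      · field_simp
        linear_combination (-K x y) * h0
      · field_simp; ring
  obtain ⟨i, p, q, hP, h⟩ := case0 key
  exact ⟨i, p, q, hP, by rw [linConj3_iff, fam_eval, hO]; exact h⟩

/-- **Classification of degree-3 foliations with a single singular point of
algebraic multiplicity 3.**
Let `F` be a degree-3 foliation of `ℙ²(ℂ)` whose singular locus is the single point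
`[0:0:1]`, of algebraic multiplicity 3, i.e. `F` is given by
`ω = A dx + B dy + C(x dy − y dx)` with `A, B, C` homogeneous of degree 3 such that the
only common zeros in `ℂ³∖{0}` of the coefficients of the associated 1-form `Ω` are the
multiples of `(0,0,1)`.  Then `Ω` is `GL₃(ℂ)`-conjugate (up to a nonzero scalar) to a
member of one of the eight listed families, and members of two different families are
never linearly conjugate. -/
theorem stmt_6 (A B Cc : MvPolynomial (Fin 2) ℂ)
    (hA : A.IsHomogeneous 3) (hB : B.IsHomogeneous 3) (hC : Cc.IsHomogeneous 3)
    (hsing : ∀ v : Fin 3 → ℂ, v ≠ 0 →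
      ((∀ i, eval v (OmABC A B Cc i) = 0) ↔ (v 0 = 0 ∧ v 1 = 0))) :
    (∃ (i : Fin 8) (p q : ℂ), Par i p q ∧ LinConj3 (OmABC A B Cc) (fam i p q)) ∧
    (∀ (i j : Fin 8) (p q p' q' : ℂ), i ≠ j → Par i p q → Par j p' q' →
      ¬ LinConj3 (fam i p q) (fam j p' q')) := by
  exact ⟨existence A B Cc hA hB hC hsing, distinct⟩
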